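/- arXiv:2207.03238 — 2 statements merged into one kernel-verified Lean document; each statement's English description precedes it below -/
import Mathlib

section
/- (Entropy Distribution Principle.) Let (X,d) be a compact metric space, f: X → X a continuous map, and ε > 0. Given a set Z ⊂ X and a constant s ≥ 0, suppose there exist a constant C > 0 and a Borel probability measure η on X satisfying: (i) η(Z) > 0; and (ii) η(B_n(x,ε)) ≤ C e^{−ns} for every n ∈ ℕ and every dynamical ball B_n(x,ε) with B_n(x,ε) ∩ Z ≠ ∅. Then h(Z,f,ε) ≥ s. -/
open Filter Set MeasureTheory
open scoped ENNReal NNReal Topology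

noncomputable section

variable {Y : Type*}

/-- The dynamical (Bowen) distance `d_n` associated to a distance function `d`. -/
def dynDist (d : Y → Y → ℝ) (f : Y → Y) (n : ℕ) (x y : Y) : ℝ :=
  ⨆ j : Fin n, d (f^[(j : ℕ)] x) (f^[(j : ℕ)] y)

/-- The `(n,ε)`-dynamical ball around `x`. -/
def dynBall (d : Y → Y → ℝ) (f : Y → Y) (n : ℕ) (ε : ℝ) (x : Y) : Set Y :=
  {y | dynDist d f n x y < ε}

/-- A set `E` is `(n,ε)`-separated if distinct points of `E` are at `d_n`-distance `> ε`. -/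
def IsDynSep (d : Y → Y → ℝ) (f : Y → Y) (n : ℕ) (ε : ℝ) (E : Set Y) : Prop :=
  E.Pairwise fun x y => ε < dynDist d f n x y

/-- Maximal cardinality of an `(n,ε)`-separated subset of `P`. -/
def sepMaxCard (d : Y → Y → ℝ) (f : Y → Y) (n : ℕ) (ε : ℝ) (P : Set Y) : ℕ :=
  sSup {m | ∃ E : Finset Y, ↑E ⊆ P ∧ IsDynSep d f n ε ↑E ∧ E.card = m}

/-- `h(f,ε) = limsup_n (1/n) log s(f,n,ε)` (computed inside `P`). -/
def hSep (d : Y → Y → ℝ) (f : Y → Y) (P : Set Y) (ε : ℝ) : EReal :=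
  Filter.limsup (fun n : ℕ => ((Real.log (sepMaxCard d f n ε P) / n : ℝ) : EReal)) Filter.atTop

/-- Upper metric mean dimension (separated-sets version). -/
def mdimSep (d : Y → Y → ℝ) (f : Y → Y) (P : Set Y) : EReal :=
  Filter.limsup (fun ε : ℝ => hSep d f P ε * (((|Real.log ε|)⁻¹ : ℝ) : EReal))
    (nhdsWithin (0 : ℝ) (Set.Ioi 0))

/-- The Carathéodory sum `m(Z,s,N,ε)`: infimum over countable covers of `Z` by dynamical
balls of lengths `≥ N` of `Σ exp(−s·n_i)`. -/
def mCover (d : Y → Y → ℝ) (f : Y → Y) (Z : Set Y) (s : ℝ) (N : ℕ) (ε : ℝ) : ℝ≥0∞ :=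
  ⨅ (Γ : Set (Y × ℕ)) (_ : Γ.Countable) (_ : ∀ q ∈ Γ, N ≤ q.2)
    (_ : Z ⊆ ⋃ q ∈ Γ, dynBall d f q.2 ε q.1),
      ∑' q : Γ, ENNReal.ofReal (Real.exp (-(s * ((q : Y × ℕ).2 : ℝ))))

/-- `m(Z,s,ε) = lim_{N→∞} m(Z,s,N,ε)` (a monotone limit, hence a supremum). -/
def mCarat (d : Y → Y → ℝ) (f : Y → Y) (Z : Set Y) (s : ℝ) (ε : ℝ) : ℝ≥0∞ :=
  ⨆ N : ℕ, mCover d f Z s N ε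

/-- `h(Z,f,ε) = inf {s : m(Z,s,ε) = 0}`. -/
def hCov (d : Y → Y → ℝ) (f : Y → Y) (Z : Set Y) (ε : ℝ) : ℝ :=
  sInf {s : ℝ | mCarat d f Z s ε = 0}

/-- Upper metric mean dimension of `f` on the (possibly non-compact) subset `Z`. -/
def mdimC (d : Y → Y → ℝ) (f : Y → Y) (Z : Set Y) : EReal :=
  Filter.limsup (fun ε : ℝ => ((hCov d f Z ε * (|Real.log ε|)⁻¹ : ℝ) : EReal))
    (nhdsWithin (0 : ℝ) (Set.Ioi 0))

/-- Birkhoff average `(1/n) Σ_{j<n} φ(f^j x)`. -/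
def birkhoff (f : Y → Y) (φ : Y → ℝ) (n : ℕ) (x : Y) : ℝ :=
  (∑ j ∈ Finset.range n, φ (f^[j] x)) / n

/-- The level set `K_α`. -/
def Kset (f : Y → Y) (φ : Y → ℝ) (α : ℝ) : Set Y :=
  {x | Filter.Tendsto (fun n : ℕ => birkhoff f φ n x) Filter.atTop (nhds α)}

/-- The set `P(α,δ,n)`. -/
def Pset (f : Y → Y) (φ : Y → ℝ) (α δ : ℝ) (n : ℕ) : Set Y :=
  {x | |birkhoff f φ n x - α| < δ}

/-- Minimal number of `(n,ε)`-dynamical balls needed to cover `P`. -/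
def coverMinCard (d : Y → Y → ℝ) (f : Y → Y) (n : ℕ) (ε : ℝ) (P : Set Y) : ℕ :=
  sInf {m | ∃ F : Finset Y, F.card = m ∧ P ⊆ ⋃ x ∈ F, dynBall d f n ε x}

/-- `Λ_φ(α,ε) = lim_{δ→0} liminf_n (1/n) log N(α,δ,n,ε)` (a monotone limit, hence an
infimum over `δ > 0`). -/
def LambdaEps (d : Y → Y → ℝ) (f : Y → Y) (φ : Y → ℝ) (α ε : ℝ) : EReal :=
  ⨅ (δ : ℝ) (_ : 0 < δ),
    Filter.liminf (fun n : ℕ =>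
      ((Real.log (coverMinCard d f n ε (Pset f φ α δ n)) / n : ℝ) : EReal)) Filter.atTop

/-- `Λ_φ mdim_M(f,α,d) = limsup_{ε→0} Λ_φ(α,ε)/|log ε|`. -/
def LambdaMdim (d : Y → Y → ℝ) (f : Y → Y) (φ : Y → ℝ) (α : ℝ) : EReal :=
  Filter.limsup (fun ε : ℝ => LambdaEps d f φ α ε * (((|Real.log ε|)⁻¹ : ℝ) : EReal))
    (nhdsWithin (0 : ℝ) (Set.Ioi 0))

/-- A finite Borel partition of `X`. -/
structure FinBorelPartition (X : Type*) [MeasurableSpace X] where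
  parts : Finset (Set X)
  meas : ∀ s ∈ parts, MeasurableSet s
  cover : ∀ x : X, ∃ s ∈ parts, x ∈ s
  disj : ∀ s ∈ parts, ∀ t ∈ parts, s ≠ t → Disjoint s t

/-- The dynamical refinement `ξ^n = ⋁_{j=0}^{n−1} f^{−j} ξ` of a finite family of sets. -/
def dynRefine {X : Type*} (f : X → X) (P : Finset (Set X)) (n : ℕ) : Finset (Set X) :=
  letI := Classical.decEq (Set X)
  ((Finset.range n).pi fun _ => P).image fun c =>
    ⋂ (j : ℕ) (h : j ∈ Finset.range n), f^[j] ⁻¹' c j h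

/-- Entropy `H_μ(P) = Σ_C −μ(C) log μ(C)` of a finite family of sets. -/
def partEntropy {X : Type*} [MeasurableSpace X] (μ : Measure X) (P : Finset (Set X)) : ℝ :=
  ∑ s ∈ P, Real.negMulLog (μ s).toReal

/-- `h_μ(f,ξ) = lim_n (1/n) H_μ(ξ^n)`. -/
def dynEntropy {X : Type*} [MeasurableSpace X] (f : X → X) (μ : Measure X)
    (ξ : FinBorelPartition X) : ℝ :=
  Filter.limsup (fun n : ℕ => partEntropy μ (dynRefine f ξ.parts n) / n) Filter.atTop

/-- `H_φ mdim_M(f,α,d)`. -/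
def HphiMdim {X : Type*} [MetricSpace X] [MeasurableSpace X] (f : X → X) (φ : X → ℝ)
    (α : ℝ) : EReal :=
  Filter.limsup (fun ε : ℝ =>
    (⨆ (μ : ProbabilityMeasure X)
        (_ : Measure.map f (μ : Measure X) = (μ : Measure X) ∧
             ∫ x, φ x ∂(μ : Measure X) = α),
      ⨅ (ξ : FinBorelPartition X) (_ : ∀ s ∈ ξ.parts, Metric.diam s < ε),
        ((dynEntropy f (μ : Measure X) ξ : ℝ) : EReal)) * (((|Real.log ε|)⁻¹ : ℝ) : EReal))
    (nhdsWithin (0 : ℝ) (Set.Ioi 0))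

/-- The specification property. -/
def SpecificationProperty {X : Type*} [MetricSpace X] (f : X → X) : Prop :=
  ∀ ε : ℝ, 0 < ε → ∃ m : ℕ, ∀ (k : ℕ) (a b : Fin k → ℕ) (x : Fin k → X),
    (∀ j, a j ≤ b j) →
    (∀ (j : ℕ) (h : j + 1 < k), b ⟨j, Nat.lt_of_succ_lt h⟩ + m ≤ a ⟨j + 1, h⟩) →
    ∃ y : X, ∀ (j : Fin k) (p : ℕ), p ≤ b j - a j →
      dist (f^[p + a j] y) (f^[p] (x j)) < ε


/-- The distance function of a metric space, as a plain function. -/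
def mDist (X : Type*) [MetricSpace X] : X → X → ℝ := fun x y => dist x y

end

theorem dynDist_lt_of_forall_lt {Y : Type*} {d : Y → Y → ℝ} {f : Y → Y} {n : ℕ} {ε : ℝ}
    {x y : Y} (hε : 0 < ε) (h : ∀ j < n, d (f^[j] x) (f^[j] y) < ε) :
    dynDist d f n x y < ε := by
  unfold dynDist
  cases isEmpty_or_nonempty (Fin n)
  · rwa [Real.iSup_of_isEmpty]
  · obtain ⟨j, hj⟩ :=
      exists_eq_ciSup_of_finite (f := fun j : Fin n => d (f^[(j : ℕ)] x) (f^[(j : ℕ)] y))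
    rw [← hj]
    exact h j j.2

theorem mCover_mono {Y : Type*} (d : Y → Y → ℝ) (f : Y → Y) (Z : Set Y) (s ε : ℝ) :
    Monotone fun N => mCover d f Z s N ε := by
  intro N M hNM
  refine le_iInf₂ fun Γ hΓ => le_iInf₂ fun hM hcov => ?_
  exact iInf₂_le_of_le Γ hΓ (iInf₂_le_of_le (fun q hq => hNM.trans (hM q hq)) hcov le_rfl)

/-- Dynamical balls of length `n` cover a compact space at a cost growing at most
exponentially in `n`. -/
theorem exists_mCover_le {X : Type*} [MetricSpace X] [CompactSpace X] [Nonempty X]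
    (f : X → X) {ε : ℝ} (hε : 0 < ε) :
    ∃ K : ℕ, ∀ (Z : Set X) (s : ℝ) (n : ℕ),
      mCover (mDist X) f Z s n ε ≤ (K : ℝ≥0∞) ^ n * ENNReal.ofReal (Real.exp (-(s * n))) := by
  classical
  obtain ⟨t, -, htfin, ht⟩ :=
    (isCompact_univ (X := X)).finite_cover_balls (half_pos hε)
  have : Fintype t := htfin.fintype
  refine ⟨Fintype.card t, fun Z s n => ?_⟩
  let P : (Fin n → t) → X → Prop := fun c y => ∀ j : Fin n, dist (f^[(j : ℕ)] y) (c j) < ε / 2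
  let g : (Fin n → t) → X × ℕ := fun c => (Classical.epsilon (P c), n)
  have hg : ∀ q ∈ range g, q.2 = n := by rintro _ ⟨c, rfl⟩; rfl
  refine (iInf₂_le_of_le (range g) (countable_range g) <| iInf₂_le_of_le
    (fun q hq => (hg q hq).ge) ?_ le_rfl).trans ?_
  · intro y _
    have hy : ∀ j : Fin n, ∃ c : t, dist (f^[(j : ℕ)] y) c < ε / 2 := by
      intro j
      obtain ⟨c, hc, hyc⟩ := mem_iUnion₂.1 (ht (mem_univ (f^[(j : ℕ)] y)))
      exact ⟨⟨c, hc⟩, hyc⟩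
    choose c hc using hy
    have hP : P c (Classical.epsilon (P c)) := Classical.epsilon_spec (p := P c) ⟨y, hc⟩
    refine mem_iUnion₂.2 ⟨g c, mem_range_self c, dynDist_lt_of_forall_lt hε fun j hj => ?_⟩
    calc dist (f^[j] (Classical.epsilon (P c))) (f^[j] y)
        ≤ dist (f^[j] (Classical.epsilon (P c))) (c ⟨j, hj⟩) + dist (f^[j] y) (c ⟨j, hj⟩) :=
          dist_triangle_right _ _ _
      _ < ε / 2 + ε / 2 := add_lt_add (hP ⟨j, hj⟩) (hc ⟨j, hj⟩)
      _ = ε := add_halves ε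
  · calc ∑' q : range g, ENNReal.ofReal (Real.exp (-(s * ((q : X × ℕ).2 : ℝ))))
        = ∑' _ : range g, ENNReal.ofReal (Real.exp (-(s * n))) :=
          tsum_congr fun q => by rw [hg q q.2]
      _ = (range g).encard * ENNReal.ofReal (Real.exp (-(s * n))) := ENNReal.tsum_set_const _ _
      _ ≤ _ := by
        gcongr
        have h : (range g).encard ≤ ((Fintype.card t ^ n : ℕ) : ℕ∞) := by
          rw [← image_univ]
          refine (encard_image_le g univ).trans ?_
          simp [encard_univ]
        calc ((range g).encard : ℝ≥0∞) ≤ (((Fintype.card t ^ n : ℕ) : ℕ∞) : ℝ≥0∞) :=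
              ENat.toENNReal_le.2 h
          _ = (Fintype.card t : ℝ≥0∞) ^ n := by rw [ENat.toENNReal_coe, Nat.cast_pow]

theorem exists_mCarat_eq_zero {X : Type*} [MetricSpace X] [CompactSpace X] [Nonempty X]
    (f : X → X) (Z : Set X) {ε : ℝ} (hε : 0 < ε) :
    ∃ s : ℝ, mCarat (mDist X) f Z s ε = 0 := by
  obtain ⟨K, hK⟩ := exists_mCover_le f hε
  obtain ⟨s, hs⟩ : ∃ s : ℝ, K * Real.exp (-s) < 1 := by
    refine ⟨K, ?_⟩
    rw [Real.exp_neg, ← div_eq_mul_inv, div_lt_one (Real.exp_pos _)]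
    linarith [Real.add_one_le_exp (K : ℝ)]
  refine ⟨s, ENNReal.iSup_eq_zero.2 fun N => ?_⟩
  have hr : (K : ℝ≥0∞) * ENNReal.ofReal (Real.exp (-s)) < 1 := by
    rw [← ENNReal.ofReal_natCast, ← ENNReal.ofReal_mul (Nat.cast_nonneg K)]
    exact ENNReal.ofReal_lt_one.2 hs
  refine le_antisymm (ge_of_tendsto (ENNReal.tendsto_pow_atTop_nhds_zero_of_lt_one hr) ?_) bot_le
  filter_upwards [eventually_ge_atTop N] with n hn
  refine (mCover_mono _ f Z s ε hn).trans ((hK Z s n).trans_eq ?_)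
  rw [mul_pow, ← ENNReal.ofReal_pow (Real.exp_pos _).le, ← Real.exp_nat_mul]
  congr 4
  ring

/-- The mass distribution estimate: a measure with exponentially small dynamical balls is
dominated by the Carathéodory sums. -/
theorem measure_le_mul_mCover {X : Type*} [MeasurableSpace X] {d : X → X → ℝ} {f : X → X}
    {ε : ℝ} {Z : Set X} {t C : ℝ} (hC : 0 < C) (η : Measure X)
    (hball : ∀ (n : ℕ) (x : X), (dynBall d f n ε x ∩ Z).Nonempty →
      η (dynBall d f n ε x) ≤ ENNReal.ofReal (C * Real.exp (-(t * n)))) (N : ℕ) :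
    η Z ≤ ENNReal.ofReal C * mCover d f Z t N ε := by
  rw [mul_comm, ← ENNReal.div_le_iff (ENNReal.ofReal_pos.2 hC).ne' ENNReal.ofReal_ne_top]
  refine le_iInf₂ fun Γ hΓ => le_iInf₂ fun _ hcov => ?_
  rw [ENNReal.div_le_iff (ENNReal.ofReal_pos.2 hC).ne' ENNReal.ofReal_ne_top, mul_comm,
    ← ENNReal.tsum_mul_left]
  have : Countable Γ := hΓ.to_subtype
  calc η Z ≤ η (⋃ q : Γ, dynBall d f q.1.2 ε q.1.1 ∩ Z) := by
        refine measure_mono fun z hz => ?_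
        obtain ⟨q, hq, hzq⟩ := mem_iUnion₂.1 (hcov hz)
        exact mem_iUnion.2 ⟨⟨q, hq⟩, hzq, hz⟩
    _ ≤ ∑' q : Γ, η (dynBall d f q.1.2 ε q.1.1 ∩ Z) := measure_iUnion_le _
    _ ≤ _ := by
        refine ENNReal.tsum_le_tsum fun q => ?_
        rcases (dynBall d f q.1.2 ε q.1.1 ∩ Z).eq_empty_or_nonempty with he | hne
        · simp [he]
        · rw [← ENNReal.ofReal_mul hC.le]
          exact (measure_mono inter_subset_left).trans (hball _ _ hne)

/-- Lemma 3.7 (Entropy Distribution Principle). -/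
theorem entropy_distribution_principle
    {X : Type*} [MetricSpace X] [CompactSpace X] [MeasurableSpace X] [BorelSpace X]
    (f : X → X) (hf : Continuous f) (ε : ℝ) (hε : 0 < ε)
    (Z : Set X) (s : ℝ) (hs : 0 ≤ s) (C : ℝ) (hC : 0 < C)
    (η : ProbabilityMeasure X) (hZ : 0 < (η : Measure X) Z)
    (hball : ∀ (n : ℕ) (x : X), (dynBall (mDist X) f n ε x ∩ Z).Nonempty →
      (η : Measure X) (dynBall (mDist X) f n ε x)
        ≤ ENNReal.ofReal (C * Real.exp (-(n * s)))) :
    s ≤ hCov (mDist X) f Z ε := by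
  have : Nonempty X := (nonempty_of_measure_ne_zero hZ.ne').to_type
  refine le_csInf (exists_mCarat_eq_zero f Z hε) fun t ht => ?_
  by_contra! hts
  have hle := measure_le_mul_mCover hC (η : Measure X) (t := t) (fun n x hx =>
    (hball n x hx).trans <| ENNReal.ofReal_le_ofReal <| by
      have : t * n ≤ n * s := by rw [mul_comm]; gcongr
      gcongr) 0
  rw [ENNReal.iSup_eq_zero.1 ht 0, mul_zero] at hle
  exact hZ.not_ge hle
end

section
/- Let (X,d) be a compact metric space, f: X → X continuous, φ: X → ℝ continuous and α ∈ ℝ. Let δ_k → 0 be positive reals, n_k → ∞ natural numbers, and for each k let C_k be a nonempty finite subset of P(α,δ_k,n_k). Define the Borel probability measures μ_k = (1/#C_k) Σ_{x ∈ C_k} (1/n_k) Σ_{i=0}^{n_k−1} δ_{f^i(x)}. Then every weak* accumulation point μ of the sequence (μ_k) is an f-invariant Borel probability measure satisfying ∫_X φ dμ = α. -/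
open Filter Set MeasureTheory
open scoped ENNReal NNReal Topology

theorem birkhoff_comp_sub {Y : Type*} (f : Y → Y) (g : Y → ℝ) (n : ℕ) (x : Y) :
    birkhoff f (fun y => g (f y) - g y) n x = (g (f^[n] x) - g x) / n := by
  simp only [birkhoff, ← Function.iterate_succ_apply' f]
  rw [Finset.sum_range_sub (fun j => g (f^[j] x)), Function.iterate_zero_apply]

/-- The average over `x ∈ C` of the empirical measures of the orbit segments of length `n`. -/
noncomputable def orbitMeasure {X : Type*} [MeasurableSpace X] (f : X → X) (C : Finset X)
    (n : ℕ) : Measure X :=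
  (C.card : ℝ≥0∞)⁻¹ •
    ∑ x ∈ C, ((n : ℝ≥0∞)⁻¹ • ∑ i ∈ Finset.range n, Measure.dirac (f^[i] x))

theorem integral_orbitMeasure {X : Type*} [MeasurableSpace X] [MeasurableSingletonClass X]
    (f : X → X) (C : Finset X) {n : ℕ} (hn : n ≠ 0) (g : X → ℝ) :
    ∫ x, g x ∂(orbitMeasure f C n) = (C.card : ℝ)⁻¹ * ∑ x ∈ C, birkhoff f g n x := by
  have hdirac (y : X) : Integrable g (Measure.dirac y) :=
    integrable_dirac (by finiteness)
  have hsum (x : X) : Integrable g (∑ i ∈ Finset.range n, Measure.dirac (f^[i] x)) :=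
    integrable_finsetSum_measure.2 fun i _ => hdirac _
  have hinv : (n : ℝ≥0∞)⁻¹ ≠ ∞ := by simpa using hn
  rw [orbitMeasure, integral_smul_measure,
    integral_finsetSum_measure fun x _ => (hsum x).smul_measure hinv]
  simp only [integral_smul_measure, integral_finsetSum_measure fun i _ => hdirac _,
    integral_dirac, smul_eq_mul, ENNReal.toReal_inv, ENNReal.toReal_natCast, birkhoff,
    div_eq_inv_mul]

theorem abs_integral_orbitMeasure_sub_le {X : Type*} [MeasurableSpace X]
    [MeasurableSingletonClass X] (f : X → X) {C : Finset X} (hC : C.Nonempty) {n : ℕ}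
    (hn : n ≠ 0) (g : X → ℝ) {a ε : ℝ} (h : ∀ x ∈ C, |birkhoff f g n x - a| ≤ ε) :
    |∫ x, g x ∂(orbitMeasure f C n) - a| ≤ ε := by
  have hcard : (0 : ℝ) < C.card := by exact_mod_cast hC.card_pos
  have heq : (C.card : ℝ)⁻¹ * ∑ x ∈ C, birkhoff f g n x - a =
      (∑ x ∈ C, (birkhoff f g n x - a)) / C.card := by
    rw [Finset.sum_sub_distrib, Finset.sum_const, nsmul_eq_mul]
    field_simp
  rw [integral_orbitMeasure f C hn g, heq, abs_div, abs_of_pos hcard, div_le_iff₀ hcard]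
  calc |∑ x ∈ C, (birkhoff f g n x - a)| ≤ ∑ x ∈ C, |birkhoff f g n x - a| :=
        Finset.abs_sum_le_sum_abs _ _
    _ ≤ ∑ _x ∈ C, ε := Finset.sum_le_sum h
    _ = ε * C.card := by rw [Finset.sum_const, nsmul_eq_mul, mul_comm]

theorem tendsto_integral_orbitMeasure {X : Type*} [MeasurableSpace X]
    [MeasurableSingletonClass X] (f : X → X) {C : ℕ → Finset X} (hC : ∀ k, (C k).Nonempty)
    {n : ℕ → ℕ} (hn : Tendsto n atTop atTop) (g : X → ℝ) {a : ℝ} {ε : ℕ → ℝ}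
    (hε : Tendsto ε atTop (𝓝 0))
    (h : ∀ k, ∀ x ∈ C k, |birkhoff f g (n k) x - a| ≤ ε k) :
    Tendsto (fun k => ∫ x, g x ∂(orbitMeasure f (C k) (n k))) atTop (𝓝 a) := by
  rw [tendsto_iff_dist_tendsto_zero]
  refine squeeze_zero' (Eventually.of_forall fun _ => dist_nonneg) ?_ hε
  filter_upwards [hn.eventually_ne_atTop 0] with k hk
  exact abs_integral_orbitMeasure_sub_le f (hC k) hk g (h k)

/-- Empirical measures along orbits of points in `P(α,δ_k,n_k)`: every weak* accumulation
point is an `f`-invariant probability measure `μ` with `∫ φ dμ = α`. -/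
theorem accumulation_point_invariant_integral_eq
    {X : Type*} [MetricSpace X] [CompactSpace X] [MeasurableSpace X] [BorelSpace X]
    (f : X → X) (hf : Continuous f) (φ : X → ℝ) (hφ : Continuous φ) (α : ℝ)
    (δ : ℕ → ℝ) (hδpos : ∀ k, 0 < δ k) (hδ : Filter.Tendsto δ Filter.atTop (nhds 0))
    (n : ℕ → ℕ) (hn : Filter.Tendsto n Filter.atTop Filter.atTop)
    (Ck : ℕ → Finset X) (hCne : ∀ k, (Ck k).Nonempty)
    (hCsub : ∀ k, ↑(Ck k) ⊆ Pset f φ α (δ k) (n k))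
    (μk : ℕ → Measure X)
    (hμk : ∀ k, μk k = ((Ck k).card : ℝ≥0∞)⁻¹ •
      ∑ x ∈ Ck k, ((n k : ℝ≥0∞)⁻¹ • ∑ i ∈ Finset.range (n k), Measure.dirac (f^[i] x)))
    (μ : ProbabilityMeasure X) (ψ : ℕ → ℕ) (hψ : StrictMono ψ)
    (hconv : ∀ g : C(X, ℝ), Filter.Tendsto (fun k => ∫ x, g x ∂(μk (ψ k)))
      Filter.atTop (nhds (∫ x, g x ∂(μ : Measure X)))) :
    Measure.map f (μ : Measure X) = (μ : Measure X) ∧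
    ∫ x, φ x ∂(μ : Measure X) = α := by
  obtain rfl : μk = fun k => orbitMeasure f (Ck k) (n k) := funext hμk
  have integral_eq (g : C(X, ℝ)) {a : ℝ} {ε : ℕ → ℝ} (hε : Tendsto ε atTop (𝓝 0))
      (h : ∀ k, ∀ x ∈ Ck k, |birkhoff f g (n k) x - a| ≤ ε k) :
      ∫ x, g x ∂(μ : Measure X) = a :=
    tendsto_nhds_unique (hconv g)
      ((tendsto_integral_orbitMeasure f hCne hn g hε h).comp hψ.tendsto_atTop)
  refine ⟨?_, integral_eq ⟨φ, hφ⟩ hδ fun k x hx => le_of_lt (hCsub k hx)⟩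
  have := Measure.isProbabilityMeasure_map (μ := (μ : Measure X)) hf.aemeasurable
  refine ext_of_forall_integral_eq_of_IsFiniteMeasure fun g => ?_
  have hint {u : X → ℝ} (hu : Continuous u) : Integrable u (μ : Measure X) :=
    hu.integrable_of_hasCompactSupport (HasCompactSupport.of_compactSpace u)
  rw [integral_map hf.aemeasurable g.continuous.aestronglyMeasurable, ← sub_eq_zero,
    ← integral_sub (hint (u := fun x => g (f x)) (by fun_prop)) (hint g.continuous)]
  have hlim : Tendsto (fun k => 2 * ‖g‖ / (n k : ℝ)) atTop (𝓝 0) :=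
    (tendsto_const_div_atTop_nhds_zero_nat (2 * ‖g‖)).comp hn
  refine integral_eq ⟨fun x => g (f x) - g x, by fun_prop⟩ hlim fun k x _ => ?_
  rw [ContinuousMap.coe_mk, birkhoff_comp_sub, sub_zero, abs_div, Nat.abs_cast]
  gcongr
  exact g.dist_le_two_norm _ _
end
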